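/- arXiv:1209.6258 — 8 statements merged into one kernel-verified Lean document; each statement's English description precedes it below -/
import Mathlib

section
/- Let Q be an affine monoid, let M ⊆ gp(Q) be a finitely generated Q-module and let U ⊆ M be a Q-submodule. Then there exist finitely many elements m_1, …, m_l ∈ M∖U and faces F_1, …, F_l of Q such that M∖U = ⋃_{i=1}^{l} (gp(F_i) + m_i) ∩ M, and for each i the face F_i is maximal (with respect to inclusion) among the faces G of Q satisfying G + m_i ⊆ M∖U. -/
open scoped Pointwise

/-- The lattice `ℤ^N`. -/
abbrev ZN (N : ℕ) : Type := Fin N → ℤ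

/-- The subgroup of `ℤ^N` generated by a submonoid `Q`, i.e. `gp(Q)`. -/
def gp {N : ℕ} (Q : AddSubmonoid (ZN N)) : AddSubgroup (ZN N) :=
  AddSubgroup.closure (Q : Set (ZN N))

/-- `F` is a face of the monoid `Q`. -/
def IsFace {N : ℕ} (Q F : AddSubmonoid (ZN N)) : Prop :=
  F ≤ Q ∧ ∀ a b : ZN N, a ∈ Q → b ∈ Q → (a + b ∈ F ↔ a ∈ F ∧ b ∈ F)

/-- The normalization (saturation) `sat(Q)` of `Q`:
all `q ∈ gp(Q)` such that `n • q ∈ Q` for some `n ≥ 1`. -/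
def sat {N : ℕ} (Q : AddSubmonoid (ZN N)) : AddSubmonoid (ZN N) where
  carrier := {q | q ∈ gp Q ∧ ∃ n : ℕ, 1 ≤ n ∧ n • q ∈ Q}
  zero_mem' := ⟨(gp Q).zero_mem, 1, le_refl 1, by simpa using Q.zero_mem⟩
  add_mem' := by
    rintro a b ⟨ha, n, hn, hna⟩ ⟨hb, m, hm, hmb⟩
    refine ⟨(gp Q).add_mem ha hb, n * m,
      Nat.one_le_iff_ne_zero.mpr (Nat.mul_ne_zero (by omega) (by omega)), ?_⟩
    have h1 : (n * m) • a ∈ Q := by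
      rw [mul_comm, mul_smul]; exact AddSubmonoid.nsmul_mem Q hna m
    have h2 : (n * m) • b ∈ Q := by
      rw [mul_smul]; exact AddSubmonoid.nsmul_mem Q hmb n
    rw [smul_add]; exact Q.add_mem h1 h2

/-- `Q` is contained in its normalization. -/
theorem le_sat {N : ℕ} (Q : AddSubmonoid (ZN N)) : Q ≤ sat Q := fun q hq =>
  ⟨AddSubgroup.subset_closure hq, 1, le_refl 1, by simpa using hq⟩

/-- The set of holes `sat(Q) ∖ Q`. -/
def holes {N : ℕ} (Q : AddSubmonoid (ZN N)) : Set (ZN N) :=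
  (sat Q : Set (ZN N)) \ (Q : Set (ZN N))

/-- The localization `Q_F = {q - f : q ∈ Q, f ∈ F}`. -/
def loc {N : ℕ} (Q F : AddSubmonoid (ZN N)) : AddSubmonoid (ZN N) where
  carrier := {x | ∃ q ∈ Q, ∃ f ∈ F, x = q - f}
  zero_mem' := ⟨0, Q.zero_mem, 0, F.zero_mem, by simp⟩
  add_mem' := by
    rintro a b ⟨q, hq, f, hf, rfl⟩ ⟨q', hq', f', hf', rfl⟩
    exact ⟨q + q', Q.add_mem hq hq', f + f', F.add_mem hf hf', by ring⟩

/-- `F` is a maximal face (w.r.t. inclusion) among the faces `G` of `Q` with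
`G + m ⊆ D`. -/
def IsMaxFaceFor {N : ℕ} (Q : AddSubmonoid (ZN N)) (D : Set (ZN N))
    (F : AddSubmonoid (ZN N)) (m : ZN N) : Prop :=
  IsFace Q F ∧ (∀ f ∈ F, f + m ∈ D) ∧
    ∀ G : AddSubmonoid (ZN N), IsFace Q G → (∀ g ∈ G, g + m ∈ D) → F ≤ G → G = F

/-- `gp(F) + q` is a family of holes of `Q` (with the face `F` and base point `q`). -/
def IsFamilyOfHolesWith {N : ℕ} (Q F : AddSubmonoid (ZN N)) (q : ZN N) : Prop :=
  q ∈ holes Q ∧ IsMaxFaceFor Q (holes Q) F q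

/-- `S ⊆ gp(Q)` is a family of holes of `Q`. -/
def IsFamilyOfHoles {N : ℕ} (Q : AddSubmonoid (ZN N)) (S : Set (ZN N)) : Prop :=
  ∃ (q : ZN N) (F : AddSubmonoid (ZN N)), IsFamilyOfHolesWith Q F q ∧
    S = (fun f => f + q) '' (gp F : Set (ZN N))

/-- `M ⊆ gp(Q)` is a `Q`-module. -/
def IsQModule {N : ℕ} (Q : AddSubmonoid (ZN N)) (M : Set (ZN N)) : Prop :=
  M ⊆ (gp Q : Set (ZN N)) ∧ ∀ q ∈ Q, ∀ m ∈ M, q + m ∈ M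

/-- `M` is a finitely generated `Q`-module: a finite union of translates of `Q`. -/
def IsFGQModule {N : ℕ} (Q : AddSubmonoid (ZN N)) (M : Set (ZN N)) : Prop :=
  IsQModule Q M ∧ ∃ s : Finset (ZN N), ↑s ⊆ M ∧
    M = ⋃ m ∈ s, {x | ∃ q ∈ Q, x = m + q}

/-- The rank of a subgroup of `ℤ^N`. -/
noncomputable def rk {N : ℕ} (A : AddSubgroup (ZN N)) : ℕ :=
  Module.finrank ℤ (AddSubgroup.toIntSubmodule A)

/-- The face `F₀` of units of `Q`. -/
def unitsFace {N : ℕ} (Q : AddSubmonoid (ZN N)) : AddSubmonoid (ZN N) where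
  carrier := {q | q ∈ Q ∧ -q ∈ Q}
  zero_mem' := ⟨Q.zero_mem, by simpa using Q.zero_mem⟩
  add_mem' := by
    rintro a b ⟨ha, ha'⟩ ⟨hb, hb'⟩
    exact ⟨Q.add_mem ha hb, by rw [neg_add]; exact Q.add_mem ha' hb'⟩

/-- The *dimension of a face `F` of `Q`: `rank gp(F) - rank gp(F₀)`. -/
noncomputable def sdim {N : ℕ} (Q F : AddSubmonoid (ZN N)) : ℕ :=
  rk (gp F) - rk (gp (unitsFace Q))

/-- The *dimension of `Q`: `rank gp(Q) - rank gp(F₀)`. -/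
noncomputable def sdimQ {N : ℕ} (Q : AddSubmonoid (ZN N)) : ℕ :=
  rk (gp Q) - rk (gp (unitsFace Q))

/-- `Q` is seminormal: `2q, 3q ∈ Q` implies `q ∈ Q` for `q ∈ gp(Q)`. -/
def Seminormal {N : ℕ} (Q : AddSubmonoid (ZN N)) : Prop :=
  ∀ q ∈ gp Q, (2 : ℕ) • q ∈ Q → (3 : ℕ) • q ∈ Q → q ∈ Q

/-- The canonical embedding `ℤ^N → ℚ^N`. -/
def toQ {N : ℕ} (x : ZN N) : Fin N → ℚ := fun i => (x i : ℚ)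

/-- The `ℚ`-linear span of (the image in `ℚ^N` of) a submonoid `F` of `ℤ^N`. -/
def qspan {N : ℕ} (F : AddSubmonoid (ZN N)) : Submodule ℚ (Fin N → ℚ) :=
  Submodule.span ℚ (toQ '' (F : Set (ZN N)))

/-- A face of the monoid generated by `S` is generated by the elements of `S` it contains. -/
theorem IsFace.closure_inter_eq {N : ℕ} {S : Set (ZN N)} {F : AddSubmonoid (ZN N)}
    (hF : IsFace (AddSubmonoid.closure S) F) : AddSubmonoid.closure (S ∩ F) = F := by
  apply le_antisymm
  · exact (AddSubmonoid.closure_le).2 Set.inter_subset_right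
  · have key : ∀ x ∈ AddSubmonoid.closure S, x ∈ F → x ∈ AddSubmonoid.closure (S ∩ F) := by
      intro x hx
      induction hx using AddSubmonoid.closure_induction with
      | mem x hx => exact fun h => AddSubmonoid.subset_closure ⟨hx, h⟩
      | zero => exact fun _ => zero_mem _
      | add x y hx hy ihx ihy =>
        intro h
        obtain ⟨h1, h2⟩ := (hF.2 x y hx hy).1 h
        exact add_mem (ihx h1) (ihy h2)
    exact fun x hx => key x (hF.1 hx) hx

/-- A finitely generated monoid has only finitely many faces. -/
theorem finite_setOf_isFace {N : ℕ} {Q : AddSubmonoid (ZN N)} (hQ : Q.FG) :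
    {F | IsFace Q F}.Finite := by
  obtain ⟨S, rfl⟩ := hQ
  refine (S.finite_toSet.powerset.image AddSubmonoid.closure).subset fun F hF => ?_
  exact ⟨_, Set.inter_subset_left, hF.closure_inter_eq⟩

/-- The units of `Q` form a face. -/
theorem isFace_unitsFace {N : ℕ} (Q : AddSubmonoid (ZN N)) : IsFace Q (unitsFace Q) := by
  refine ⟨fun x hx => hx.1, fun a b ha hb => ⟨fun h => ⟨⟨ha, ?_⟩, hb, ?_⟩,
    fun h => add_mem h.1 h.2⟩⟩
  · simpa using add_mem hb h.2
  · simpa using add_mem ha h.2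

/-- Every element of `M \ U` admits a maximal face. -/
theorem exists_isMaxFaceFor {N : ℕ} {Q : AddSubmonoid (ZN N)} (hQ : Q.FG)
    {M U : Set (ZN N)} (hM : ∀ q ∈ Q, ∀ m ∈ M, q + m ∈ M)
    (hU : ∀ q ∈ Q, ∀ u ∈ U, q + u ∈ U) {x : ZN N} (hx : x ∈ M \ U) :
    ∃ F, IsMaxFaceFor Q (M \ U) F x := by
  have hfin : {F | IsFace Q F ∧ ∀ f ∈ F, f + x ∈ M \ U}.Finite :=
    (finite_setOf_isFace hQ).subset fun F hF => hF.1
  have hunits : ∀ f ∈ unitsFace Q, f + x ∈ M \ U := fun f hf =>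
    ⟨hM f hf.1 x hx.1, fun h => hx.2 (by simpa using hU _ hf.2 _ h)⟩
  obtain ⟨F, -, hF⟩ := hfin.exists_le_maximal ⟨isFace_unitsFace Q, hunits⟩
  exact ⟨F, hF.prop.1, hF.prop.2, fun G hG hGx hFG => (hF.eq_of_le ⟨hG, hGx⟩ hFG).symm⟩

/-- For a sequence `x` and a submonoid `F` of `Q`, the elements `q ∈ Q` such that each `q + x k`
divides some term of `x` up to an element of `F` form a face containing `F`. -/
theorem exists_isFace_absorbing {N : ℕ} {Q F : AddSubmonoid (ZN N)} (hF : F ≤ Q)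
    (x : ℕ → ZN N) :
    ∃ G : AddSubmonoid (ZN N), IsFace Q G ∧ F ≤ G ∧
      ∀ q, q ∈ G ↔ q ∈ Q ∧ ∀ k, ∃ l, ∃ f ∈ F, x l + f - (q + x k) ∈ Q := by
  let G : AddSubmonoid (ZN N) :=
    { carrier := {q | q ∈ Q ∧ ∀ k, ∃ l, ∃ f ∈ F, x l + f - (q + x k) ∈ Q}
      zero_mem' := ⟨zero_mem _, fun k => ⟨k, 0, zero_mem _, by simp⟩⟩
      add_mem' := by
        rintro a b ⟨ha, ha'⟩ ⟨hb, hb'⟩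
        refine ⟨add_mem ha hb, fun k => ?_⟩
        obtain ⟨l, f, hf, h⟩ := hb' k
        obtain ⟨l', f', hf', h'⟩ := ha' l
        refine ⟨l', f' + f, add_mem hf' hf, ?_⟩
        convert add_mem h h' using 1
        abel }
  refine ⟨G, ⟨fun q hq => hq.1, fun a b ha hb => ⟨fun h => ?_, fun h => add_mem h.1 h.2⟩⟩,
    fun f hf => ⟨hF hf, fun k => ⟨k, f, hf, ?_⟩⟩, fun q => Iff.rfl⟩
  · refine ⟨⟨ha, fun k => ?_⟩, hb, fun k => ?_⟩
    · obtain ⟨l, f, hf, h⟩ := h.2 k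
      refine ⟨l, f, hf, ?_⟩
      convert add_mem h hb using 1
      abel
    · obtain ⟨l, f, hf, h⟩ := h.2 k
      refine ⟨l, f, hf, ?_⟩
      convert add_mem h ha using 1
      abel
  · simp [add_comm]

/-- Given a sequence in a translate of `Q` all of whose terms have `F` as a maximal face, some
later term differs from an earlier one by an element of `F`. -/
theorem exists_sub_mem_of_isMaxFaceFor {N : ℕ} {Q : AddSubmonoid (ZN N)} (hQ : Q.FG)
    {M U : Set (ZN N)} (hM : ∀ q ∈ Q, ∀ m ∈ M, q + m ∈ M)
    (hU : ∀ q ∈ Q, ∀ u ∈ U, q + u ∈ U) {F : AddSubmonoid (ZN N)} {m : ZN N} {x : ℕ → ZN N}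
    (hx : ∀ k, IsMaxFaceFor Q (M \ U) F (x k)) (hxm : ∀ k, ∃ q ∈ Q, x k = m + q) :
    ∃ k l, k < l ∧ x l - x k ∈ F := by
  obtain ⟨S, hS⟩ := hQ
  have hc : ∀ k, ∃ c : S → ℕ, x k = m + ∑ i : S, c i • (i : ZN N) := by
    intro k
    obtain ⟨q, hq, h⟩ := hxm k
    rw [← hS, AddSubmonoid.mem_closure_finset'] at hq
    obtain ⟨c, rfl⟩ := hq
    exact ⟨c, h⟩
  choose c hc using hc
  obtain ⟨g, hg⟩ := (wellQuasiOrdered_le (α := S → ℕ)).exists_monotone_subseq c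
  have hmem : ∀ i : S, (i : ZN N) ∈ Q := fun i => hS ▸ AddSubmonoid.subset_closure i.2
  have hsub : ∀ k l, k ≤ l →
      x (g l) - x (g k) = ∑ i : S, (c (g l) i - c (g k) i) • (i : ZN N) := by
    intro k l hkl
    rw [hc, hc, add_sub_add_left_eq_sub, ← Finset.sum_sub_distrib]
    refine Finset.sum_congr rfl fun i _ => ?_
    rw [sub_nsmul _ (hg k l hkl i), sub_eq_add_neg]
  obtain ⟨G, hG, hFG, hmemG⟩ := exists_isFace_absorbing (hx 0).1.1 (x ∘ g)
  have hGF : G = F := by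
    refine (hx (g 0)).2.2 G hG (fun q hq => ?_) hFG
    obtain ⟨hqQ, hq⟩ := (hmemG q).1 hq
    have h0 := (hx (g 0)).2.1 0 (zero_mem _)
    rw [zero_add] at h0
    refine ⟨hM q hqQ _ h0.1, fun hqU => ?_⟩
    obtain ⟨l, f, hf, h⟩ := hq 0
    refine ((hx (g l)).2.1 f hf).2 ?_
    simpa [add_comm] using hU _ h _ hqU
  have hbdd : ∀ i : S, (i : ZN N) ∉ F → ∃ K, ∀ l, c (g l) i ≤ c (g K) i := by
    intro i hi
    by_contra! hcon
    refine hi (hGF ▸ (hmemG _).2 ⟨hmem i, fun k => ?_⟩)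
    obtain ⟨l, hl⟩ := hcon k
    have hkl : k ≤ l := by
      by_contra! h
      exact absurd (hg l k h.le i) hl.not_ge
    refine ⟨l, 0, zero_mem _, ?_⟩
    have : (x ∘ g) l + 0 - (i + (x ∘ g) k) = (x (g l) - x (g k)) - i := by
      simp only [Function.comp_apply]; abel
    rw [this, hsub k l hkl, ← Finset.add_sum_erase _ _ (Finset.mem_univ i)]
    obtain ⟨d, hd⟩ : ∃ d, c (g l) i - c (g k) i = d + 1 := ⟨c (g l) i - c (g k) i - 1, by omega⟩
    rw [hd, succ_nsmul, add_right_comm, add_sub_cancel_right]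
    exact add_mem (nsmul_mem (hmem i) _) (sum_mem fun j _ => nsmul_mem (hmem j) _)
  choose! K hK using hbdd
  have hle : ∀ i, K i ≤ Finset.univ.sup K := fun i => Finset.le_sup (Finset.mem_univ i)
  refine ⟨g (Finset.univ.sup K), g (Finset.univ.sup K + 1), g.strictMono (Nat.lt_succ_self _), ?_⟩
  rw [hsub _ _ (Nat.le_succ _)]
  refine sum_mem fun i _ => ?_
  by_cases hi : (i : ZN N) ∈ F
  · exact nsmul_mem hi _
  · rw [Nat.sub_eq_zero_of_le ((hK i hi _).trans (hg _ _ (hle i) i)), zero_nsmul]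
    exact zero_mem _

/-- The elements of `gp F` are the differences of elements of `F`. -/
theorem mem_gp_iff {N : ℕ} {F : AddSubmonoid (ZN N)} {x : ZN N} :
    x ∈ gp F ↔ ∃ f ∈ F, ∃ g ∈ F, f - g = x := by
  constructor
  · intro hx
    induction hx using AddSubgroup.closure_induction with
    | mem x hx => exact ⟨x, hx, 0, zero_mem _, sub_zero x⟩
    | zero => exact ⟨0, zero_mem _, 0, zero_mem _, sub_zero 0⟩
    | add x y _ _ ihx ihy =>
      obtain ⟨f, hf, g, hg, rfl⟩ := ihx
      obtain ⟨f', hf', g', hg', rfl⟩ := ihy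
      exact ⟨f + f', add_mem hf hf', g + g', add_mem hg hg', add_sub_add_comm _ _ _ _⟩
    | neg x _ ih =>
      obtain ⟨f, hf, g, hg, rfl⟩ := ih
      exact ⟨g, hg, f, hf, (neg_sub f g).symm⟩
  · rintro ⟨f, hf, g, hg, rfl⟩
    exact sub_mem (AddSubgroup.subset_closure hf) (AddSubgroup.subset_closure hg)

/-- Translates of `gp F` by elements differing by an element of `F` coincide. -/
theorem image_add_gp_eq {N : ℕ} {F : AddSubmonoid (ZN N)} {x y : ZN N} (h : y - x ∈ F) :
    (fun f => f + x) '' (gp F : Set (ZN N)) = (fun f => f + y) '' (gp F : Set (ZN N)) := by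
  have h' : y - x ∈ gp F := AddSubgroup.subset_closure h
  ext z
  constructor
  · rintro ⟨f, hf, rfl⟩
    exact ⟨f - (y - x), sub_mem hf h', by dsimp only; abel⟩
  · rintro ⟨f, hf, rfl⟩
    exact ⟨f + (y - x), add_mem hf h', by simp [add_assoc]⟩

/-- The translates of groups `gp F` by elements having `F` as a maximal face are finite in
number. -/
theorem finite_image_isMaxFaceFor {N : ℕ} {Q : AddSubmonoid (ZN N)} (hQ : Q.FG)
    {M U : Set (ZN N)} (hM : IsFGQModule Q M) (hU : ∀ q ∈ Q, ∀ u ∈ U, q + u ∈ U) :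
    ((fun p : AddSubmonoid (ZN N) × ZN N => (fun f => f + p.2) '' (gp p.1 : Set (ZN N))) ''
      {p | IsMaxFaceFor Q (M \ U) p.1 p.2}).Finite := by
  obtain ⟨⟨-, hMQ⟩, s, -, hs⟩ := hM
  have hfix : ∀ F : AddSubmonoid (ZN N), ∀ m : ZN N,
      ((fun x => (fun f => f + x) '' (gp F : Set (ZN N))) ''
        {x | IsMaxFaceFor Q (M \ U) F x ∧ ∃ q ∈ Q, x = m + q}).Finite := by
    intro F m
    by_contra hinf
    have hinf : Set.Infinite _ := hinf
    choose x hx hxe using fun k => (hinf.natEmbedding _ k).2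
    obtain ⟨k, l, hkl, h⟩ :=
      exists_sub_mem_of_isMaxFaceFor hQ hMQ hU (fun k => (hx k).1) fun k => (hx k).2
    have h := image_add_gp_eq h
    exact hkl.ne ((hinf.natEmbedding _).injective
      (Subtype.ext ((hxe k).symm.trans (h.trans (hxe l)))))
  refine ((finite_setOf_isFace hQ).biUnion fun F _ =>
    s.finite_toSet.biUnion fun m _ => hfix F m).subset ?_
  rintro _ ⟨⟨F, x⟩, hx, rfl⟩
  have hxM : x ∈ M := by simpa using (hx.2.1 0 (zero_mem _)).1
  rw [hs] at hxM
  simp only [Set.mem_iUnion] at hxM ⊢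
  obtain ⟨m, hm, hxm⟩ := hxM
  exact ⟨F, hx.1, m, hm, x, ⟨hx, hxm⟩, rfl⟩

/-- Existence of a finite decomposition of `M ∖ U` into pieces
`(gp(Fᵢ) + mᵢ) ∩ M` with each `Fᵢ` maximal among the faces `G` with `G + mᵢ ⊆ M ∖ U`. -/
theorem exists_decomposition {N : ℕ} (Q : AddSubmonoid (ZN N)) (hQ : Q.FG)
    (M U : Set (ZN N)) (hM : IsFGQModule Q M) (hUM : U ⊆ M)
    (hU : ∀ q ∈ Q, ∀ u ∈ U, q + u ∈ U) :
    ∃ (l : ℕ) (m : Fin l → ZN N) (F : Fin l → AddSubmonoid (ZN N)),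
      (∀ i, m i ∈ M \ U) ∧
      (∀ i, IsMaxFaceFor Q (M \ U) (F i) (m i)) ∧
      M \ U = ⋃ i, ((fun f => f + m i) '' (gp (F i) : Set (ZN N))) ∩ M := by
  obtain ⟨t, ht, htfin, htim⟩ :=
    (finite_image_isMaxFaceFor hQ hM hU).exists_subset_finite_image_eq subset_rfl
  obtain ⟨l, ⟨e⟩⟩ := finite_iff_exists_equiv_fin.1 htfin.to_subtype
  have hmax : ∀ i, IsMaxFaceFor Q (M \ U) (e.symm i).1.1 (e.symm i).1.2 :=
    fun i => ht (e.symm i).2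
  refine ⟨l, fun i => (e.symm i).1.2, fun i => (e.symm i).1.1,
    fun i => by simpa using (hmax i).2.1 0 (zero_mem _), hmax, ?_⟩
  ext y
  simp only [Set.mem_iUnion]
  constructor
  · intro hy
    obtain ⟨F, hF⟩ := exists_isMaxFaceFor hQ hM.1.2 hU hy
    obtain ⟨p, hp, hpe⟩ := htim.ge ⟨(F, y), hF, rfl⟩
    refine ⟨e ⟨p, hp⟩, ?_, hy.1⟩
    rw [e.symm_apply_apply]
    exact hpe.ge ⟨0, zero_mem _, zero_add y⟩
  · rintro ⟨i, ⟨h, hh, rfl⟩, hyM⟩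
    refine ⟨hyM, fun hyU => ?_⟩
    obtain ⟨f, hf, g, hg, rfl⟩ := mem_gp_iff.1 hh
    refine ((hmax i).2.1 f hf).2 ?_
    convert hU g ((hmax i).1.1 hg) _ hyU using 1
    dsimp only
    abel
end

section
/- Let Q be an affine monoid, let M ⊆ gp(Q) be a finitely generated Q-module and let U ⊆ M be a Q-submodule. Suppose M∖U = ⋃_{i=1}^{l} (gp(G_i) + m_i) ∩ M for finitely many elements m_i ∈ M∖U and faces G_i of Q. Then for every m ∈ M∖U and every face F of Q that is maximal (with respect to inclusion) among the faces G satisfying G + m ⊆ M∖U, there exists an index i with gp(F) + m = gp(G_i) + m_i. -/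
open scoped Pointwise

/-- Every element of `gp(G)` is a difference of two elements of `G`. -/
theorem exists_sub_of_mem_gp {N : ℕ} {G : AddSubmonoid (ZN N)} {x : ZN N} (hx : x ∈ gp G) :
    ∃ a ∈ G, ∃ b ∈ G, x = a - b := by
  refine AddSubgroup.closure_induction (p := fun x _ => ∃ a ∈ G, ∃ b ∈ G, x = a - b)
    ?_ ?_ ?_ ?_ hx
  · exact fun x hx => ⟨x, hx, 0, G.zero_mem, by simp⟩
  · exact ⟨0, G.zero_mem, 0, G.zero_mem, by simp⟩
  · rintro x y _ _ ⟨a, ha, b, hb, rfl⟩ ⟨c, hc, d, hd, rfl⟩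
    exact ⟨a + c, G.add_mem ha hc, b + d, G.add_mem hb hd, by abel⟩
  · rintro x _ ⟨a, ha, b, hb, rfl⟩
    exact ⟨b, hb, a, ha, by abel⟩

/-- A face `G` of `Q` satisfies `gp(G) ∩ Q ⊆ G`. -/
theorem IsFace.mem_of_mem_gp {N : ℕ} {Q G : AddSubmonoid (ZN N)} (hG : IsFace Q G)
    {x : ZN N} (hx : x ∈ gp G) (hxQ : x ∈ Q) : x ∈ G := by
  obtain ⟨a, ha, b, hb, rfl⟩ := exists_sub_of_mem_gp hx
  exact ((hG.2 (a - b) b hxQ (hG.1 hb)).1 (by simpa using ha)).1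

/-- If a positive multiple of `x ∈ Q` lies in a face of `Q`, then so does `x`. -/
theorem IsFace.mem_of_nsmul_mem {N : ℕ} {Q G : AddSubmonoid (ZN N)} (hG : IsFace Q G)
    {x : ZN N} (hx : x ∈ Q) {k : ℕ} (hk : k ≠ 0) (h : k • x ∈ G) : x ∈ G := by
  obtain ⟨j, rfl⟩ := Nat.exists_eq_succ_of_ne_zero hk
  rw [succ_nsmul] at h
  exact ((hG.2 _ _ (Q.nsmul_mem hx j) hx).1 h).2

/-- A face of a finitely generated monoid contains an interior element: one that is
contained in no face unless that face contains the whole given face. -/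
theorem IsFace.exists_interior {N : ℕ} {Q F : AddSubmonoid (ZN N)} (hQ : Q.FG)
    (hF : IsFace Q F) : ∃ f ∈ F, ∀ G : AddSubmonoid (ZN N), IsFace Q G → f ∈ G → F ≤ G := by
  classical
  obtain ⟨S, rfl⟩ := hQ
  refine ⟨∑ s ∈ S with s ∈ F, s, F.sum_mem fun s hs => (Finset.mem_filter.1 hs).2, ?_⟩
  intro G hG hfG x hxF
  refine AddSubmonoid.closure_induction (motive := fun x _ => x ∈ F → x ∈ G) ?_ ?_ ?_ (hF.1 hxF) hxF
  · intro s hs hsF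
    have hmem : s ∈ S.filter (· ∈ F) := Finset.mem_filter.2 ⟨hs, hsF⟩
    rw [← Finset.add_sum_erase _ _ hmem] at hfG
    refine ((hG.2 _ _ (hF.1 hsF) (AddSubmonoid.sum_mem _ fun t ht => hF.1 ?_)).1 hfG).1
    exact (Finset.mem_filter.1 (Finset.mem_of_mem_erase ht)).2
  · exact fun _ => G.zero_mem
  · intro a b ha hb iha ihb hab
    obtain ⟨haF, hbF⟩ := (hF.2 a b ha hb).1 hab
    exact G.add_mem (iha haF) (ihb hbF)

/-- Uniqueness: any finite decomposition of `M ∖ U` contains every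
set `gp(F) + m` with `F` maximal among the faces `G` with `G + m ⊆ M ∖ U`. -/
theorem decomposition_unique {N : ℕ} (Q : AddSubmonoid (ZN N)) (hQ : Q.FG)
    (M U : Set (ZN N)) (hM : IsFGQModule Q M) (hUM : U ⊆ M)
    (hU : ∀ q ∈ Q, ∀ u ∈ U, q + u ∈ U)
    (l : ℕ) (m : Fin l → ZN N) (G : Fin l → AddSubmonoid (ZN N))
    (hm : ∀ i, m i ∈ M \ U) (hG : ∀ i, IsFace Q (G i))
    (hdec : M \ U = ⋃ i, ((fun f => f + m i) '' (gp (G i) : Set (ZN N))) ∩ M)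
    (p : ZN N) (hp : p ∈ M \ U) (F : AddSubmonoid (ZN N))
    (hF : IsMaxFaceFor Q (M \ U) F p) :
    ∃ i, (fun f => f + p) '' (gp F : Set (ZN N)) =
      (fun f => f + m i) '' (gp (G i) : Set (ZN N)) := by
  obtain ⟨hFface, hFD, hFmax⟩ := hF
  obtain ⟨f, hfF, hfint⟩ := hFface.exists_interior hQ
  have hcover : ∀ n : ℕ, ∃ i, n • f + p - m i ∈ gp (G i) := by
    intro n
    have h := hFD (n • f) (F.nsmul_mem hfF n)
    rw [hdec] at h
    obtain ⟨i, ⟨g, hg, hgi⟩, -⟩ := Set.mem_iUnion.1 h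
    refine ⟨i, ?_⟩
    rw [← hgi]
    simpa using hg
  choose c hc using hcover
  obtain ⟨a, b, hab, hcab⟩ : ∃ a b, a < b ∧ c a = c b := by
    obtain ⟨a, b, hne, h⟩ := Finite.exists_ne_map_eq_of_infinite c
    rcases lt_or_gt_of_ne hne with hlt | hlt
    exacts [⟨a, b, hlt, h⟩, ⟨b, a, hlt, h.symm⟩]
  have hfQ : f ∈ Q := hFface.1 hfF
  have hfG : f ∈ G (c a) := by
    refine (hG _).mem_of_nsmul_mem hfQ (Nat.sub_ne_zero_of_lt hab)
      ((hG _).mem_of_mem_gp ?_ (Q.nsmul_mem hfQ _))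
    have h := (gp (G (c a))).sub_mem (hcab ▸ hc b) (hc a)
    rw [sub_nsmul f hab.le]
    convert h using 1
    abel
  have hpG : p - m (c a) ∈ gp (G (c a)) := by
    have h := (gp (G (c a))).sub_mem (hc a)
      ((gp (G (c a))).nsmul_mem (AddSubgroup.subset_closure hfG) a)
    convert h using 1
    abel
  have hGF : G (c a) = F := by
    refine hFmax _ (hG _) (fun g hg => ?_) (hfint _ (hG _) hfG)
    rw [hdec]
    refine Set.mem_iUnion.2 ⟨c a, ⟨g + (p - m (c a)), ?_, ?_⟩, ?_⟩
    · exact (gp _).add_mem (AddSubgroup.subset_closure hg) hpG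
    · simp [add_assoc]
    · exact hM.1.2 g ((hG _).1 hg) p hp.1
  refine ⟨c a, ?_⟩
  rw [← hGF]
  ext x
  constructor
  · rintro ⟨g, hg, rfl⟩
    exact ⟨g + (p - m (c a)), (gp _).add_mem hg hpG, by simp [add_assoc]⟩
  · rintro ⟨g, hg, rfl⟩
    exact ⟨g - (p - m (c a)), (gp _).sub_mem hg hpG, by dsimp only; abel⟩
end

section
/- Let Q be an affine monoid, let M ⊆ gp(Q) be a finitely generated Q-module and let U ⊆ M be a Q-submodule. Then the collection of subsets of gp(Q) of the form gp(F) + m, where m ∈ M∖U and F is a face of Q maximal (with respect to inclusion) among the faces G satisfying G + m ⊆ M∖U, is finite. -/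
open scoped Pointwise

theorem IsFace.eq_closure_inter {N : ℕ} {F : AddSubmonoid (ZN N)} {t : Set (ZN N)}
    (hF : IsFace (AddSubmonoid.closure t) F) :
    F = AddSubmonoid.closure (t ∩ (F : Set (ZN N))) := by
  apply le_antisymm
  · intro x hx
    induction hF.1 hx using AddSubmonoid.closure_induction with
    | mem x h => exact AddSubmonoid.subset_closure ⟨h, hx⟩
    | zero => exact AddSubmonoid.zero_mem _
    | add x y hxt hyt ihx ihy =>
      obtain ⟨h1, h2⟩ := (hF.2 x y hxt hyt).1 hx
      exact AddSubmonoid.add_mem _ (ihx h1) (ihy h2)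
  · exact AddSubmonoid.closure_le.2 Set.inter_subset_right

/-- A finitely generated submonoid is the image of some `ℕ^ι` with `ι` finite. -/
theorem exists_addMonoidHom_mrange_eq {N : ℕ} {Q : AddSubmonoid (ZN N)} (hQ : Q.FG) :
    ∃ (t : Finset (ZN N)) (φ : (t → ℕ) →+ ZN N), AddMonoidHom.mrange φ = Q := by
  obtain ⟨t, rfl⟩ := hQ
  refine ⟨t, ⟨⟨fun a => ∑ i : t, a i • i.1, by simp⟩, fun a b => ?_⟩, ?_⟩
  · simp [add_smul, Finset.sum_add_distrib]
  · ext x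
    rw [AddSubmonoid.mem_closure_finset']
    simp [AddMonoidHom.mem_mrange, eq_comm]

/-- In a monotone sequence of naturals, increments starting late enough can be added to any term
without exceeding all later terms. -/
theorem eventually_add_sub_le_of_monotone {b : ℕ → ℕ} (hb : Monotone b) :
    ∀ᶠ n in Filter.atTop, ∀ m ≥ n, ∀ l, ∀ᶠ k in Filter.atTop, b l + (b m - b n) ≤ b k := by
  rcases tendsto_atTop_of_monotone hb with h | ⟨c, hc⟩
  · exact Filter.Eventually.of_forall fun n m _ l => h.eventually_ge_atTop _
  · rw [nhds_discrete, Filter.tendsto_pure, Filter.eventually_atTop] at hc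
    obtain ⟨n₀, hn₀⟩ := hc
    filter_upwards [Filter.eventually_ge_atTop n₀] with n hn m hm l
    filter_upwards [Filter.eventually_ge_atTop l] with k hk
    rw [hn₀ n hn, hn₀ m (hn.trans hm), Nat.sub_self, add_zero]
    exact hb hk

theorem exists_add_sub_le_of_monotone {ι : Type*} [Finite ι] {a : ℕ → ι → ℕ} (ha : Monotone a) :
    ∃ n, ∀ m ≥ n, ∀ l, ∃ k, a l + (a m - a n) ≤ a k := by
  have h : ∀ᶠ n in Filter.atTop, ∀ i, ∀ m ≥ n, ∀ l, ∀ᶠ k in Filter.atTop,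
      a l i + (a m i - a n i) ≤ a k i :=
    Filter.eventually_all.2 fun i =>
      eventually_add_sub_le_of_monotone fun _ _ hxy => ha hxy i
  obtain ⟨n, hn⟩ := h.exists
  refine ⟨n, fun m hm l => ?_⟩
  obtain ⟨k, hk⟩ := (Filter.eventually_all.2 fun i => hn i m hm l).exists
  exact ⟨k, hk⟩

/-- The elements of `Q` dividing, modulo `F`, an increment of the sequence `p` starting at any
prescribed term. -/
def absorbedFace {N : ℕ} (Q F : AddSubmonoid (ZN N)) (p : ℕ → ZN N) : AddSubmonoid (ZN N) where
  carrier := {g | g ∈ Q ∧ ∀ l, ∃ k, ∃ h ∈ Q, ∃ f ∈ F, h + (g + p l) = f + p k}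
  zero_mem' := ⟨Q.zero_mem, fun l => ⟨l, 0, Q.zero_mem, 0, F.zero_mem, by simp⟩⟩
  add_mem' := by
    rintro a b ⟨ha, ha'⟩ ⟨hb, hb'⟩
    refine ⟨Q.add_mem ha hb, fun l => ?_⟩
    obtain ⟨k, h, hh, f, hf, e⟩ := ha' l
    obtain ⟨k', h', hh', f', hf', e'⟩ := hb' k
    refine ⟨k', h + h', Q.add_mem hh hh', f + f', F.add_mem hf hf', ?_⟩
    linear_combination e + e'

theorem isFace_absorbedFace {N : ℕ} (Q F : AddSubmonoid (ZN N)) (p : ℕ → ZN N) :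
    IsFace Q (absorbedFace Q F p) := by
  refine ⟨fun g hg => hg.1, fun a b ha hb => ⟨fun hab => ?_, fun h => add_mem h.1 h.2⟩⟩
  refine ⟨⟨ha, fun l => ?_⟩, ⟨hb, fun l => ?_⟩⟩
  · obtain ⟨k, h, hh, f, hf, e⟩ := hab.2 l
    exact ⟨k, h + b, Q.add_mem hh hb, f, hf, by rw [← e]; abel⟩
  · obtain ⟨k, h, hh, f, hf, e⟩ := hab.2 l
    exact ⟨k, h + a, Q.add_mem hh ha, f, hf, by rw [← e]; abel⟩

theorem le_absorbedFace {N : ℕ} {Q F : AddSubmonoid (ZN N)} (hF : F ≤ Q) (p : ℕ → ZN N) :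
    F ≤ absorbedFace Q F p :=
  fun f hf => ⟨hF hf, fun l => ⟨l, 0, Q.zero_mem, f, hf, by simp⟩⟩

/-- If `F` is maximal at every term of a sequence, it contains every absorbed element. -/
theorem absorbedFace_eq {N : ℕ} {Q F : AddSubmonoid (ZN N)} {M U : Set (ZN N)}
    (hM : ∀ q ∈ Q, ∀ m ∈ M, q + m ∈ M) (hU : ∀ q ∈ Q, ∀ u ∈ U, q + u ∈ U) {p : ℕ → ZN N}
    (hp : ∀ n, p n ∈ M) (hF : ∀ n, IsMaxFaceFor Q (M \ U) F (p n)) :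
    absorbedFace Q F p = F := by
  refine (hF 0).2.2 _ (isFace_absorbedFace Q F p) (fun g hg => ?_) (le_absorbedFace (hF 0).1.1 p)
  refine ⟨hM g hg.1 _ (hp 0), fun hgU => ?_⟩
  obtain ⟨k, h, hh, f, hf, e⟩ := hg.2 0
  exact ((hF k).2.1 f hf).2 (e ▸ hU h hh _ hgU)

theorem image_add_right_gp_eq {N : ℕ} {F : AddSubmonoid (ZN N)} {p d : ZN N} (hd : d ∈ F) :
    (fun f => f + (d + p)) '' (gp F : Set (ZN N)) = (fun f => f + p) '' (gp F : Set (ZN N)) := by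
  have hd' : d ∈ gp F := AddSubgroup.subset_closure hd
  ext x
  constructor
  · rintro ⟨f, hf, rfl⟩
    exact ⟨f + d, (gp F).add_mem hf hd', by simp only; abel⟩
  · rintro ⟨f, hf, rfl⟩
    exact ⟨f - d, (gp F).sub_mem hf hd', by simp only; abel⟩

/-- For a fixed face `F` and a fixed translate `c + Q`, there are only finitely many families. -/
theorem finite_families_of_isFace {N : ℕ} {Q : AddSubmonoid (ZN N)} (hQ : Q.FG)
    {M U : Set (ZN N)} (hM : ∀ q ∈ Q, ∀ m ∈ M, q + m ∈ M) (hU : ∀ q ∈ Q, ∀ u ∈ U, q + u ∈ U)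
    (F : AddSubmonoid (ZN N)) (c : ZN N) :
    {S : Set (ZN N) | ∃ q ∈ Q, c + q ∈ M ∧ IsMaxFaceFor Q (M \ U) F (c + q) ∧
      S = (fun f => f + (c + q)) '' (gp F : Set (ZN N))}.Finite := by
  obtain ⟨t, φ, rfl⟩ := exists_addMonoidHom_mrange_eq hQ
  by_contra hinf
  let e := Set.Infinite.natEmbedding _ hinf
  have he : ∀ n, ∃ a : t → ℕ, c + φ a ∈ M ∧
      IsMaxFaceFor (AddMonoidHom.mrange φ) (M \ U) F (c + φ a) ∧
      (e n : Set (ZN N)) = (fun f => f + (c + φ a)) '' (gp F : Set (ZN N)) := by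
    intro n
    obtain ⟨_, ⟨a, rfl⟩, h⟩ := (e n).2
    exact ⟨a, h⟩
  choose a haM haF haS using he
  obtain ⟨g, hg⟩ :=
    (wellQuasiOrdered_le (α := t → ℕ)).exists_monotone_subseq a
  obtain ⟨n, hn⟩ := exists_add_sub_le_of_monotone (a := fun i => a (g i)) fun x y h => hg x y h
  have hle : a (g n) ≤ a (g (n + 1)) := hg _ _ n.le_succ
  have hd : φ (a (g (n + 1)) - a (g n)) ∈ F := by
    rw [← absorbedFace_eq hM hU (fun i => haM (g i)) (fun i => haF (g i))]
    refine ⟨⟨_, rfl⟩, fun l => ?_⟩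
    obtain ⟨k, hk⟩ := hn (n + 1) n.le_succ l
    refine ⟨k, _, ⟨a (g k) - (a (g l) + (a (g (n + 1)) - a (g n))), rfl⟩, 0, F.zero_mem, ?_⟩
    have h := congrArg φ (tsub_add_cancel_of_le hk)
    simp only [map_add] at h ⊢
    rw [← h]
    abel
  have hS : (e (g (n + 1)) : Set (ZN N)) = e (g n) := by
    rw [haS, haS, ← image_add_right_gp_eq (p := c + φ (a (g n))) hd, add_left_comm, ← map_add,
      tsub_add_cancel_of_le hle]
  have := g.injective (e.injective (Subtype.ext hS))
  omega

/-- The collection of sets `gp(F) + m`, for `m ∈ M ∖ U` and `F`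
maximal among the faces `G` with `G + m ⊆ M ∖ U`, is finite. -/
theorem families_finite {N : ℕ} (Q : AddSubmonoid (ZN N)) (hQ : Q.FG)
    (M U : Set (ZN N)) (hM : IsFGQModule Q M) (hUM : U ⊆ M)
    (hU : ∀ q ∈ Q, ∀ u ∈ U, q + u ∈ U) :
    {S : Set (ZN N) | ∃ p ∈ M \ U, ∃ F : AddSubmonoid (ZN N),
      IsMaxFaceFor Q (M \ U) F p ∧
      S = (fun f => f + p) '' (gp F : Set (ZN N))}.Finite := by
  obtain ⟨⟨-, hM⟩, s, -, hs⟩ := hM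
  refine ((finite_setOf_isFace hQ).biUnion fun F _ => s.finite_toSet.biUnion fun c _ =>
    finite_families_of_isFace hQ hM hU F c).subset ?_
  rintro S ⟨p, hp, F, hF, rfl⟩
  have hp' := hp.1
  rw [hs] at hp'
  simp only [Set.mem_iUnion] at hp'
  obtain ⟨c, hc, q, hq, rfl⟩ := hp'
  simp only [Set.mem_iUnion]
  exact ⟨F, hF.1, c, hc, q, hq, hp.1, hF, rfl⟩
end

section
/- Let k be a field, let Q be an affine monoid, and let C denote the quotient of k[sat(Q)] by the image of k[Q], regarded as a k[Q]-module. For a face F of Q, the ideal p_F is an associated prime of the k[Q]-module C if and only if there exists q ∈ sat(Q)∖Q such that F is maximal (with respect to inclusion) among the faces G of Q satisfying G + q ⊆ sat(Q)∖Q. -/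
open scoped Pointwise

/-- The inclusion of monoids `Q ⊆ sat Q` as an additive monoid homomorphism. -/
def satIncl {N : ℕ} (Q : AddSubmonoid (ZN N)) : ↥Q →+ ↥(sat Q) :=
  AddSubmonoid.inclusion (le_sat Q)

/-- The induced ring homomorphism `k[Q] →+* k[sat Q]`. -/
noncomputable def satMap (k : Type) [Field k] {N : ℕ} (Q : AddSubmonoid (ZN N)) :
    AddMonoidAlgebra k ↥Q →+* AddMonoidAlgebra k ↥(sat Q) :=
  AddMonoidAlgebra.mapDomainRingHom k (satIncl Q)

/-- `k[sat Q]` as a `k[Q]`-algebra (hence a `k[Q]`-module) via the inclusion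
of monoids `Q ⊆ sat Q`. -/
noncomputable instance satAlg (k : Type) [Field k] {N : ℕ} (Q : AddSubmonoid (ZN N)) :
    Algebra (AddMonoidAlgebra k ↥Q) (AddMonoidAlgebra k ↥(sat Q)) :=
  (satMap k Q).toAlgebra

/-- The monomial ideal `p_F ⊆ k[Q]`, spanned by the monomials `x^q` with `q ∈ Q ∖ F`.
(Since `F` is a face, the ideal generated by these monomials coincides with their
`k`-linear span.) -/
noncomputable def pIdeal (k : Type) [Field k] {N : ℕ} (Q F : AddSubmonoid (ZN N)) :
    Ideal (AddMonoidAlgebra k ↥Q) :=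
  Ideal.span {x | ∃ q : ↥Q, (q : ZN N) ∉ F ∧ x = AddMonoidAlgebra.single q (1 : k)}

/-- The quotient `C` of `k[sat Q]` by the image of `k[Q]`, as a `k[Q]`-module. -/
noncomputable abbrev holeModule (k : Type) [Field k] {N : ℕ} (Q : AddSubmonoid (ZN N)) :=
  AddMonoidAlgebra k ↥(sat Q) ⧸
    LinearMap.range (Algebra.linearMap (AddMonoidAlgebra k ↥Q) (AddMonoidAlgebra k ↥(sat Q)))

section

variable {k : Type} [Field k] {N : ℕ} {Q F : AddSubmonoid (ZN N)}

/-- The ideal `p_F` consists of the elements whose support avoids `F`. -/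
theorem mem_pIdeal_iff (hF : IsFace Q F) {r : AddMonoidAlgebra k Q} :
    r ∈ pIdeal k Q F ↔ ∀ m ∈ r.coeff.support, (m : ZN N) ∉ F := by
  have hset : {x | ∃ q : Q, (q : ZN N) ∉ F ∧ x = AddMonoidAlgebra.single q (1 : k)} =
      AddMonoidAlgebra.of' k Q '' {q : Q | (q : ZN N) ∉ F} := by
    ext x
    simp only [Set.mem_ofPred_eq, Set.mem_image, AddMonoidAlgebra.of', eq_comm]
  rw [pIdeal, hset, AddMonoidAlgebra.mem_ideal_span_of'_image]
  refine forall₂_congr fun m _ => ⟨?_, fun h => ⟨m, h, 0, (zero_add m).symm⟩⟩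
  rintro ⟨m', hm', d, rfl⟩ h
  exact hm' ((hF.2 d m' d.2 m'.2).1 h).2

theorem single_mem_pIdeal_iff (hF : IsFace Q F) (q : Q) :
    AddMonoidAlgebra.single q (1 : k) ∈ pIdeal k Q F ↔ (q : ZN N) ∉ F := by
  rw [mem_pIdeal_iff hF]
  simp

open Classical in
/-- The monoid homomorphism `Q → k[ℤ^N]` sending `q` to `x^q` if `q ∈ F` and to `0` otherwise. -/
noncomputable def faceMonoidHom (k : Type) [Field k] (hF : IsFace Q F) :
    Multiplicative Q →* AddMonoidAlgebra k (ZN N) where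
  toFun q := if (q.toAdd : ZN N) ∈ F then AddMonoidAlgebra.single (q.toAdd : ZN N) 1 else 0
  map_one' := by simp [AddMonoidAlgebra.one_def]
  map_mul' a b := by
    simp only [toAdd_mul, AddSubmonoid.coe_add, hF.2 _ _ a.toAdd.2 b.toAdd.2]
    by_cases ha : (a.toAdd : ZN N) ∈ F <;> by_cases hb : (b.toAdd : ZN N) ∈ F <;>
      simp [ha, hb, AddMonoidAlgebra.single_mul_single]

open Classical in
theorem coeff_lift_faceMonoidHom (hF : IsFace Q F) (r : AddMonoidAlgebra k Q) (m : ZN N) :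
    (AddMonoidAlgebra.lift k _ _ (faceMonoidHom k hF) r).coeff m =
      if h : m ∈ F then r.coeff ⟨m, hF.1 h⟩ else 0 := by
  induction r using AddMonoidAlgebra.induction_linear with
  | zero => simp
  | add x y hx hy =>
    rw [map_add, AddMonoidAlgebra.coeff_add, Finsupp.add_apply, hx, hy]
    split_ifs <;> simp
  | single q c =>
    rw [AddMonoidAlgebra.lift_single]
    by_cases hq : (q : ZN N) ∈ F <;> by_cases hm : m ∈ F <;>
      simp [faceMonoidHom, hq, hm, Finsupp.single_apply, Subtype.ext_iff]
    all_goals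
      rintro rfl
      contradiction

theorem pIdeal_isPrime (hF : IsFace Q F) : (pIdeal k Q F).IsPrime := by
  classical
  have h : pIdeal k Q F =
      RingHom.ker (AddMonoidAlgebra.lift k _ _ (faceMonoidHom k hF)) := by
    ext r
    rw [mem_pIdeal_iff hF, RingHom.mem_ker, ← AddMonoidAlgebra.coeff_inj, Finsupp.ext_iff]
    simp only [coeff_lift_faceMonoidHom, AddMonoidAlgebra.coeff_zero, Finsupp.coe_zero,
      Pi.zero_apply, Finsupp.mem_support_iff]
    refine ⟨fun h m => ?_, fun h m hm hmF => ?_⟩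
    · split_ifs with hm
      · by_contra hne
        exact h _ hne hm
      · rfl
    · have := h m
      rw [dif_pos hmF] at this
      exact hm this
  rw [h]
  exact RingHom.ker_isPrime _

/-- An element of `k[sat Q]` vanishes in the quotient by `k[Q]` iff its support lies in `Q`. -/
theorem holeModule_mk_eq_zero_iff {y : AddMonoidAlgebra k (sat Q)} :
    (Submodule.Quotient.mk y : holeModule k Q) = 0 ↔
      ∀ m ∈ y.coeff.support, (m : ZN N) ∈ Q := by
  classical
  rw [Submodule.Quotient.mk_eq_zero, LinearMap.mem_range]
  constructor
  · rintro ⟨r, rfl⟩ m hm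
    obtain ⟨q, -, rfl⟩ := Finset.mem_image.1 (Finsupp.mapDomain_support hm)
    exact q.2
  · intro h
    have hinj : Function.Injective (satIncl Q) := AddSubmonoid.inclusion_injective (le_sat Q)
    refine ⟨AddMonoidAlgebra.comapDomain (satIncl Q) hinj y, ?_⟩
    exact AddMonoidAlgebra.mapDomain_comapDomain
      (fun m hm => ⟨⟨m, h m hm⟩, rfl⟩) hinj

theorem smul_holeModule_mk (r : AddMonoidAlgebra k Q) (y : AddMonoidAlgebra k (sat Q)) :
    r • (Submodule.Quotient.mk y : holeModule k Q) =
      Submodule.Quotient.mk (satMap k Q r * y) := by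
  rw [← Submodule.Quotient.mk_smul, Algebra.smul_def]
  rfl

theorem single_smul_holeModule_mk_eq_zero_iff (g : Q) (y : AddMonoidAlgebra k (sat Q)) :
    AddMonoidAlgebra.single g (1 : k) • (Submodule.Quotient.mk y : holeModule k Q) = 0 ↔
      ∀ m ∈ y.coeff.support, (g : ZN N) + m ∈ Q := by
  have hg : satMap k Q (AddMonoidAlgebra.single g 1) =
      AddMonoidAlgebra.single (satIncl Q g) 1 :=
    AddMonoidAlgebra.mapDomain_single
  rw [smul_holeModule_mk, holeModule_mk_eq_zero_iff, hg]
  constructor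
  · intro h m hm
    refine h (satIncl Q g + m) ?_
    rw [Finsupp.mem_support_iff] at hm ⊢
    simpa using hm
  · intro h m hm
    by_cases hd : ∃ d, satIncl Q g + d = m
    · obtain ⟨d, rfl⟩ := hd
      refine h d ?_
      rw [Finsupp.mem_support_iff] at hm ⊢
      simpa using hm
    · push Not at hd
      rw [Finsupp.mem_support_iff, AddMonoidAlgebra.coeff_single_mul_of_forall_add_ne _ _ hd] at hm
      exact absurd rfl hm

theorem add_mem_of_smul_holeModule_mk_single_eq_zero {r : AddMonoidAlgebra k Q} {q : sat Q}
    (h : r • (Submodule.Quotient.mk (AddMonoidAlgebra.single q 1) : holeModule k Q) = 0)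
    {m : Q} (hm : m ∈ r.coeff.support) : (m : ZN N) + q ∈ Q := by
  rw [smul_holeModule_mk, holeModule_mk_eq_zero_iff] at h
  refine h (satIncl Q m + q) ?_
  rw [Finsupp.mem_support_iff] at hm ⊢
  have hinj : Function.Injective (satIncl Q) := AddSubmonoid.inclusion_injective (le_sat Q)
  rw [AddMonoidAlgebra.coeff_mul_single_add, mul_one]
  exact (Finsupp.mapDomain_apply hinj _ _).trans_ne hm

/-- The face of the monomials which do not lie in a given prime ideal. -/
def faceOfPrime (P : Ideal (AddMonoidAlgebra k Q)) [P.IsPrime] : AddSubmonoid (ZN N) where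
  carrier := {m | ∃ h : m ∈ Q, AddMonoidAlgebra.single (⟨m, h⟩ : Q) (1 : k) ∉ P}
  zero_mem' := ⟨Q.zero_mem, fun h =>
    Ideal.IsPrime.ne_top ‹_› ((Ideal.eq_top_iff_one P).2 h)⟩
  add_mem' := by
    rintro a b ⟨ha, ha'⟩ ⟨hb, hb'⟩
    refine ⟨Q.add_mem ha hb, fun h => ?_⟩
    have hab : AddMonoidAlgebra.single (⟨a, ha⟩ : Q) (1 : k) *
        AddMonoidAlgebra.single (⟨b, hb⟩ : Q) (1 : k) ∈ P := by
      rwa [AddMonoidAlgebra.single_mul_single, one_mul]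
    exact (Ideal.IsPrime.mem_or_mem ‹_› hab).elim ha' hb'

theorem isFace_faceOfPrime (P : Ideal (AddMonoidAlgebra k Q)) [P.IsPrime] :
    IsFace Q (faceOfPrime P) := by
  refine ⟨fun m hm => hm.1, fun a b ha hb => ⟨?_, fun h => (faceOfPrime P).add_mem h.1 h.2⟩⟩
  rintro ⟨hab, h⟩
  have hmul : AddMonoidAlgebra.single (⟨a + b, hab⟩ : Q) (1 : k) =
      AddMonoidAlgebra.single (⟨a, ha⟩ : Q) (1 : k) *
        AddMonoidAlgebra.single (⟨b, hb⟩ : Q) (1 : k) := by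
    rw [AddMonoidAlgebra.single_mul_single, one_mul]
    rfl
  rw [hmul] at h
  exact ⟨⟨ha, fun h' => h (P.mul_mem_right _ h')⟩, ⟨hb, fun h' => h (P.mul_mem_left _ h')⟩⟩

/-- If every element of a finite set can be moved into `Q` by an element of `F ≤ Q`, then a single
element of `F` does so simultaneously. -/
theorem exists_forall_add_mem (hF : F ≤ Q) {ι : Type*} (v : ι → ZN N) (s : Finset ι)
    (h : ∀ i ∈ s, ∃ f ∈ F, f + v i ∈ Q) : ∃ f ∈ F, ∀ i ∈ s, f + v i ∈ Q := by
  classical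
  induction s using Finset.induction_on with
  | empty => exact ⟨0, F.zero_mem, by simp⟩
  | insert a s _ ih =>
    obtain ⟨f, hf, hfs⟩ := ih fun i hi => h i (Finset.mem_insert_of_mem hi)
    obtain ⟨g, hg, hga⟩ := h a (Finset.mem_insert_self a s)
    refine ⟨f + g, F.add_mem hf hg, fun i hi => ?_⟩
    obtain rfl | hi := Finset.mem_insert.1 hi
    · rw [add_assoc]
      exact Q.add_mem (hF hf) hga
    · rw [add_comm f g, add_assoc]
      exact Q.add_mem (hF hg) (hfs i hi)

end

/-- For a face `F` of `Q`, the ideal `p_F` is an associated prime of the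
`k[Q]`-module `C = k[sat Q]/k[Q]` if and only if there is `q ∈ sat(Q) ∖ Q` such that `F`
is maximal among the faces `G` of `Q` with `G + q ⊆ sat(Q) ∖ Q`. -/
theorem pIdeal_isAssociatedPrime_iff (k : Type) [Field k] {N : ℕ}
    (Q F : AddSubmonoid (ZN N)) (hQ : Q.FG) (hF : IsFace Q F) :
    IsAssociatedPrime (pIdeal k Q F) (holeModule k Q) ↔
      ∃ q ∈ holes Q, IsMaxFaceFor Q (holes Q) F q := by
  have : AddMonoid.FG Q := (AddMonoid.fg_iff_addSubmonoid_fg Q).2 hQ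
  have : IsNoetherianRing (AddMonoidAlgebra k Q) := Algebra.FiniteType.isNoetherianRing k _
  rw [isAssociatedPrime_iff]
  constructor
  · rintro ⟨-, x, hx⟩
    obtain ⟨y, rfl⟩ := Submodule.Quotient.mk_surjective _ x
    have key (g : Q) : (g : ZN N) ∉ F ↔ ∀ m ∈ y.coeff.support, (g : ZN N) + m ∈ Q := by
      rw [← single_mem_pIdeal_iff (k := k) hF, hx, Submodule.mem_colon_singleton,
        Submodule.mem_bot, single_smul_holeModule_mk_eq_zero_iff]
    obtain ⟨h, hh, hFh⟩ : ∃ h ∈ y.coeff.support, ∀ f ∈ F, f + (h : ZN N) ∉ Q := by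
      by_contra! hcon
      obtain ⟨f, hf, hfs⟩ := exists_forall_add_mem hF.1 (fun m : sat Q => (m : ZN N)) _ hcon
      exact (key ⟨f, hF.1 hf⟩).2 hfs hf
    have hholes (f : ZN N) (hf : f ∈ F) : f + (h : ZN N) ∈ holes Q :=
      ⟨(sat Q).add_mem (le_sat Q (hF.1 hf)) h.2, hFh f hf⟩
    refine ⟨h, by simpa using hholes 0 F.zero_mem, hF, hholes, fun G hG hGh hFG => ?_⟩
    refine le_antisymm (fun g hg => ?_) hFG
    by_contra hgF
    exact (hGh g hg).2 ((key ⟨g, hG.1 hg⟩).1 hgF h hh)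
  · rintro ⟨q, hq, -, hFq, hmax⟩
    have hprime : (pIdeal k Q F).IsPrime := pIdeal_isPrime hF
    refine ⟨hprime, ?_⟩
    refine Submodule.exists_eq_colon_of_mem_minimalPrimes
      (x := Submodule.Quotient.mk (AddMonoidAlgebra.single (⟨q, hq.1⟩ : sat Q) (1 : k))) ?_
    refine ⟨⟨hprime, fun r hr => ?_⟩, ?_⟩
    · rw [Submodule.mem_colon_singleton, Submodule.mem_bot] at hr
      rw [mem_pIdeal_iff hF]
      exact fun m hm hmF =>
        (hFq m hmF).2 (add_mem_of_smul_holeModule_mk_single_eq_zero hr hm)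
    · rintro P ⟨hP, hcolon⟩ hPF
      have hface : faceOfPrime P = F := by
        refine hmax _ (isFace_faceOfPrime P) ?_ ?_
        · rintro g ⟨hgQ, hgP⟩
          refine ⟨(sat Q).add_mem (le_sat Q hgQ) hq.1, fun hgq => hgP (hcolon ?_)⟩
          rw [Submodule.mem_colon_singleton, Submodule.mem_bot,
            single_smul_holeModule_mk_eq_zero_iff]
          intro m hm
          obtain rfl := Finset.mem_singleton.1 (Finsupp.support_single_subset hm)
          exact hgq
        · exact fun f hf => ⟨hF.1 hf, fun h => (single_mem_pIdeal_iff hF _).1 (hPF h) hf⟩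
      refine Ideal.span_le.2 ?_
      rintro _ ⟨g, hg, rfl⟩
      by_contra hgP
      exact hg (hface ▸ ⟨g.2, hgP⟩)
end

section
/- Let Q be an affine monoid and F a face of Q. Then normalization and localization commute: {q ∈ gp(Q) : n•q ∈ Q_F for some integer n ≥ 1} = {s − f : s ∈ sat(Q), f ∈ F}; that is, sat(Q_F) = (sat(Q))_F. -/
open scoped Pointwise

/-- Localizing at a submonoid `F ≤ Q` does not change the generated subgroup. -/
theorem gp_loc {N : ℕ} {Q F : AddSubmonoid (ZN N)} (hF : F ≤ Q) : gp (loc Q F) = gp Q := by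
  apply le_antisymm
  · refine (AddSubgroup.closure_le _).mpr ?_
    rintro _ ⟨q, hq, f, hf, rfl⟩
    exact (gp Q).sub_mem (AddSubgroup.subset_closure hq) (AddSubgroup.subset_closure (hF hf))
  · exact AddSubgroup.closure_mono fun q hq => ⟨q, hq, 0, F.zero_mem, (sub_zero q).symm⟩

/-- Normalization and localization commute: `sat(Q_F) = (sat Q)_F`. -/
theorem sat_loc_comm {N : ℕ} (Q F : AddSubmonoid (ZN N)) (hQ : Q.FG) (hF : IsFace Q F) :
    sat (loc Q F) = loc (sat Q) F := by
  ext x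
  constructor
  · rintro ⟨hx, n, hn, q, hq, f, hf, hnx⟩
    rw [gp_loc hF.1] at hx
    refine ⟨x + f, ⟨(gp Q).add_mem hx (AddSubgroup.subset_closure (hF.1 hf)), n, hn, ?_⟩,
      f, hf, (add_sub_cancel_right x f).symm⟩
    obtain ⟨m, rfl⟩ := Nat.exists_eq_add_of_le' hn
    have h : (m + 1) • (x + f) = q + m • f := by
      rw [smul_add, hnx, succ_nsmul]
      abel
    rw [h]
    exact Q.add_mem hq (Q.nsmul_mem (hF.1 hf) m)
  · rintro ⟨s, ⟨hs, n, hn, hns⟩, f, hf, rfl⟩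
    refine ⟨?_, n, hn, n • s, hns, n • f, F.nsmul_mem hf n, smul_sub n s f⟩
    rw [gp_loc hF.1]
    exact (gp Q).sub_mem hs (AddSubgroup.subset_closure (hF.1 hf))
end

section
/- Let Q be an affine monoid, let q ∈ sat(Q) and let F be a face of Q such that F + q ⊆ sat(Q)∖Q. Then for every f ∈ gp(F) with f ∈ sat(Q), one has f + q ∈ sat(Q)∖Q. -/
open scoped Pointwise

/-- Every element of the subgroup generated by a submonoid of a commutative group
is a difference of two elements of the submonoid. -/
theorem AddSubmonoid.exists_sub_of_mem_addSubgroup_closure {G : Type*} [AddCommGroup G]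
    {F : AddSubmonoid G} {x : G} (hx : x ∈ AddSubgroup.closure (F : Set G)) :
    ∃ a ∈ F, ∃ b ∈ F, x = a - b := by
  induction hx using AddSubgroup.closure_induction with
  | mem x hx => exact ⟨x, hx, 0, F.zero_mem, (sub_zero x).symm⟩
  | zero => exact ⟨0, F.zero_mem, 0, F.zero_mem, (sub_zero 0).symm⟩
  | add x y _ _ hx hy =>
    obtain ⟨a, ha, b, hb, rfl⟩ := hx
    obtain ⟨c, hc, d, hd, rfl⟩ := hy
    exact ⟨a + c, F.add_mem ha hc, b + d, F.add_mem hb hd, sub_add_sub_comm a b c d⟩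
  | neg x _ hx =>
    obtain ⟨a, ha, b, hb, rfl⟩ := hx
    exact ⟨b, hb, a, ha, neg_sub a b⟩

/-- If `F + q ⊆ sat(Q) ∖ Q`, then `f + q ∈ sat(Q) ∖ Q` for every
`f ∈ gp(F)` with `f ∈ sat(Q)`. -/
theorem gp_face_translate_subset_holes {N : ℕ} (Q F : AddSubmonoid (ZN N))
    (hQ : Q.FG) (hF : IsFace Q F) (q : ZN N) (hq : q ∈ sat Q)
    (h : ∀ f ∈ F, f + q ∈ holes Q)
    (f : ZN N) (hf1 : f ∈ gp F) (hf2 : f ∈ sat Q) :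
    f + q ∈ holes Q := by
  obtain ⟨a, ha, b, hb, rfl⟩ := AddSubmonoid.exists_sub_of_mem_addSubgroup_closure hf1
  refine ⟨(sat Q).add_mem hf2 hq, fun hmem => (h a ha).2 ?_⟩
  have hsum : a + q = b + (a - b + q) := by abel
  rw [hsum]
  exact Q.add_mem (hF.1 hb) hmem
end

section
/- Let Q be a seminormal affine monoid and let F be a face of Q. Then the localization Q_F is seminormal; that is, for every q ∈ gp(Q), if 2q ∈ Q_F and 3q ∈ Q_F then q ∈ Q_F. -/
open scoped Pointwise

/-- Localizations of seminormal affine monoids are seminormal. -/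
theorem loc_seminormal {N : ℕ} (Q F : AddSubmonoid (ZN N)) (hQ : Q.FG)
    (hF : IsFace Q F) (hsn : Seminormal Q) (q : ZN N) (hq : q ∈ gp Q)
    (h2 : (2 : ℕ) • q ∈ loc Q F) (h3 : (3 : ℕ) • q ∈ loc Q F) :
    q ∈ loc Q F := by
  obtain ⟨a, ha, f, hf, h2⟩ := h2
  obtain ⟨b, hb, g, hg, h3⟩ := h3
  have hfQ := hF.1 hf
  have hgQ := hF.1 hg
  refine ⟨q + (f + g), hsn _ ?_ ?_ ?_, f + g, F.add_mem hf hg, by abel⟩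
  · exact (gp Q).add_mem hq (AddSubgroup.subset_closure (Q.add_mem hfQ hgQ))
  · rw [smul_add, h2, show a - f + 2 • (f + g) = a + f + 2 • g by abel]
    exact Q.add_mem (Q.add_mem ha hfQ) (Q.nsmul_mem hgQ 2)
  · rw [smul_add, h3, show b - g + 3 • (f + g) = b + 3 • f + 2 • g by abel]
    exact Q.add_mem (Q.add_mem hb (Q.nsmul_mem hfQ 3)) (Q.nsmul_mem hgQ 2)
end

section
/- Let Q be a positive seminormal affine monoid (positive meaning that 0 is the only q ∈ Q with −q ∈ Q). Then Q has no 0-*dimensional family of holes; that is, for every q ∈ sat(Q)∖Q there exists a face F of Q with F ≠ {0} such that F + q ⊆ sat(Q)∖Q. -/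
open scoped Pointwise

/-- Two consecutive multiples of `q` in `Q` put all sufficiently large multiples in `Q`. -/
theorem nsmul_mem_of_consecutive {M : Type*} [AddCommMonoid M] (Q : AddSubmonoid M) {q : M}
    {m : ℕ} (hm : m • q ∈ Q) (hm' : (m + 1) • q ∈ Q) {k : ℕ} (hk : m * m ≤ k) : k • q ∈ Q := by
  rcases Nat.eq_zero_or_pos m with rfl | hpos
  · exact Q.nsmul_mem (by simpa using hm') k
  · have hle : k % m ≤ k / m :=
      (Nat.mod_lt k hpos).le.trans ((Nat.le_div_iff_mul_le hpos).2 hk)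
    obtain ⟨d, hd⟩ := Nat.exists_eq_add_of_le hle
    have hsplit : k = d * m + k % m * (m + 1) := by
      conv_lhs => rw [← Nat.div_add_mod k m, hd]
      ring
    rw [hsplit, add_smul, mul_smul, mul_smul]
    exact Q.add_mem (Q.nsmul_mem hm d) (Q.nsmul_mem hm' _)

/-- In a seminormal monoid, `q` lies in `Q` as soon as all its large multiples do. -/
theorem Seminormal.mem_of_large_nsmul_mem {N : ℕ} {Q : AddSubmonoid (ZN N)} (hsn : Seminormal Q)
    {q : ZN N} (hq : q ∈ gp Q) (K : ℕ) (hK : ∀ k, K ≤ k → k • q ∈ Q) : q ∈ Q := by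
  induction K with
  | zero => simpa using hK 1 (Nat.zero_le 1)
  | succ K ih =>
    rcases Nat.eq_zero_or_pos K with rfl | hpos
    · simpa using hK 1 le_rfl
    · refine ih fun k hk => ?_
      rcases hk.eq_or_lt with rfl | hlt
      · refine hsn _ ((gp Q).nsmul_mem hq K) ?_ ?_
        · rw [← mul_smul]
          exact hK _ (by omega)
        · rw [← mul_smul]
          exact hK _ (by omega)
      · exact hK k hlt

/-- The elements of `Q` dividing a multiple of `q`; for `q` in the normalization this is the
smallest face of `Q` whose cone contains `q`. -/
def faceAt {N : ℕ} (Q : AddSubmonoid (ZN N)) (q : ZN N) : AddSubmonoid (ZN N) where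
  carrier := {f | f ∈ Q ∧ ∃ g ∈ Q, ∃ k : ℕ, f + g = k • q}
  zero_mem' := ⟨Q.zero_mem, 0, Q.zero_mem, 0, by simp⟩
  add_mem' := by
    rintro a b ⟨ha, g, hg, k, hk⟩ ⟨hb, g', hg', k', hk'⟩
    exact ⟨Q.add_mem ha hb, g + g', Q.add_mem hg hg', k + k', by
      rw [add_smul, ← hk, ← hk', add_add_add_comm]⟩

theorem isFace_faceAt {N : ℕ} (Q : AddSubmonoid (ZN N)) (q : ZN N) : IsFace Q (faceAt Q q) := by
  refine ⟨fun f hf => hf.1, fun a b ha hb => ⟨?_, fun h => (faceAt Q q).add_mem h.1 h.2⟩⟩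
  rintro ⟨-, g, hg, k, hk⟩
  exact ⟨⟨ha, b + g, Q.add_mem hb hg, k, by rw [← hk, add_assoc]⟩,
    ⟨hb, a + g, Q.add_mem ha hg, k, by rw [← hk, add_left_comm, add_assoc]⟩⟩

/-- A positive seminormal affine monoid has no `0`-*dimensional family
of holes: every hole admits a nontrivial face `F` with `F + q ⊆ sat(Q) ∖ Q`. -/
theorem positive_seminormal_no_zero_dim_family {N : ℕ} (Q : AddSubmonoid (ZN N))
    (hQ : Q.FG) (hpos : ∀ q ∈ Q, -q ∈ Q → q = 0) (hsn : Seminormal Q)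
    (q : ZN N) (hq : q ∈ holes Q) :
    ∃ F : AddSubmonoid (ZN N), IsFace Q F ∧ F ≠ ⊥ ∧ ∀ f ∈ F, f + q ∈ holes Q := by
  obtain ⟨hsat, hnot⟩ := hq
  obtain ⟨hgp, n, hn, hnq⟩ := id hsat
  refine ⟨faceAt Q q, isFace_faceAt Q q, fun hbot => ?_, fun f hf =>
    ⟨(sat Q).add_mem (le_sat Q hf.1) hsat, fun hfq => hnot ?_⟩⟩
  · have hmem : n • q ∈ faceAt Q q := ⟨hnq, 0, Q.zero_mem, n, add_zero _⟩
    rw [hbot, AddSubmonoid.mem_bot] at hmem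
    rcases smul_eq_zero.1 hmem with h | h
    · omega
    · exact hnot (h ▸ Q.zero_mem)
  · obtain ⟨hfQ, g, hg, m, hm⟩ := hf
    refine hsn.mem_of_large_nsmul_mem hgp (m * m) fun k hk =>
      nsmul_mem_of_consecutive Q (hm ▸ Q.add_mem hfQ hg) ?_ hk
    rw [succ_nsmul, ← hm, add_right_comm]
    exact Q.add_mem hfq hg
end
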